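/- arXiv:1412.3527 — 4 statements merged into one kernel-verified Lean document; each statement's English description precedes it below -/
import Mathlib

section
/- Let n, m be positive integers, μ > 0, and let K((z,w),(t,s)) = (m! μ^n / π^{n+m}) · Σ_{α ∈ ℕ^m} [ (m+1)_{|α|} (|α|+m)^n / α! ] · e^{μ(|α|+m)⟨z,t⟩} · w^α · conj(s)^α be the Bergman kernel series of the Fock–Bargmann–Hartogs domain D_{n,m}(μ). For every compact subset E of D_{n,m}(μ) there exists an open set G ⊆ ℂ^n × ℂ^m containing the closure of D_{n,m}(μ) such that for each fixed (t,s) ∈ E, the series defining K((z,w),(t,s)) converges absolutely at every (z,w) ∈ G and the function (z,w) ↦ K((z,w),(t,s)) is holomorphic on G. In fact, one may take G = {(z,w) : ‖w‖² < r^{−2} e^{−μ‖z‖²}} for any 0 < r < 1 with E ⊆ {(z,w) : ‖w‖² < r² e^{−μ‖z‖²}}. -/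
open scoped BigOperators

/-- The Fock–Bargmann–Hartogs domain
`D_{n,m}(μ) = {(z,w) ∈ ℂ^n × ℂ^m : ‖w‖² < exp (−μ‖z‖²)}`. -/
def FBH (n m : ℕ) (μ : ℝ) :
    Set (EuclideanSpace ℂ (Fin n) × EuclideanSpace ℂ (Fin m)) :=
  {p | ‖p.2‖ ^ 2 < Real.exp (-μ * ‖p.1‖ ^ 2)}

/-- The term of the Bergman kernel series of `D_{n,m}(μ)` indexed by the
multi-index `α ∈ ℕ^m`:
`[(m+1)_{|α|} (|α|+m)^n / α!] · exp(μ(|α|+m)⟨z,t⟩) · w^α · conj(s)^α`,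
where `(m+1)_{|α|} = ∏_{j<|α|} (m+1+j)` is the Pochhammer symbol and
`⟨z,t⟩ = ∑ j, z j · conj (t j)`. -/
noncomputable def bergmanTerm (n m : ℕ) (μ : ℝ)
    (z : EuclideanSpace ℂ (Fin n)) (w : EuclideanSpace ℂ (Fin m))
    (t : EuclideanSpace ℂ (Fin n)) (s : EuclideanSpace ℂ (Fin m))
    (α : Fin m → ℕ) : ℂ :=
  ((∏ j ∈ Finset.range (∑ i, α i), ((m : ℂ) + 1 + (j : ℂ))) *
      (((∑ i, α i : ℕ) : ℂ) + (m : ℂ)) ^ n / ((∏ i, (α i).factorial : ℕ) : ℂ)) *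
    Complex.exp ((μ : ℂ) * (((∑ i, α i : ℕ) : ℂ) + (m : ℂ)) *
      ∑ j, z j * (starRingEnd ℂ) (t j)) *
    (∏ i, (w i) ^ (α i)) * (∏ i, ((starRingEnd ℂ) (s i)) ^ (α i))

/-- The Bergman kernel of `D_{n,m}(μ)`:
`K((z,w),(t,s)) = (m! μ^n / π^{n+m}) · Σ_α bergmanTerm α`. -/
noncomputable def bergmanKernel (n m : ℕ) (μ : ℝ)
    (p q : EuclideanSpace ℂ (Fin n) × EuclideanSpace ℂ (Fin m)) : ℂ :=
  ((m.factorial : ℂ) * (μ : ℂ) ^ n / (Real.pi : ℂ) ^ (n + m)) *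
    ∑' α : Fin m → ℕ, bergmanTerm n m μ p.1 p.2 q.1 q.2 α

/-- The real majorant of a term of the series. -/
noncomputable def majTerm (n m : ℕ) (A : ℝ) (x : Fin m → ℝ) (α : Fin m → ℕ) : ℝ :=
  ((∏ j ∈ Finset.range (∑ i, α i), ((m : ℝ) + 1 + (j : ℝ))) *
      (((∑ i, α i : ℕ) : ℝ) + (m : ℝ)) ^ n / ((∏ i, (α i).factorial : ℕ) : ℝ)) *
    A ^ ((∑ i, α i) + m) * ∏ i, (x i) ^ (α i)

lemma prod_shift_eq (m k : ℕ) :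
    (∏ j ∈ Finset.range k, ((m : ℝ) + 1 + (j : ℝ))) = (k.factorial : ℝ) * ((m + k).choose k : ℝ) := by
  have h := Nat.ascFactorial_eq_factorial_mul_choose m k
  rw [Nat.ascFactorial_eq_prod_range] at h
  exact_mod_cast h

lemma sum_majTerm (n m : ℕ) (A : ℝ) (x : Fin m → ℝ) (k : ℕ) :
    ∑ α ∈ Finset.piAntidiag Finset.univ k, majTerm n m A x α =
      ((m + k).choose k : ℝ) * ((k : ℝ) + m) ^ n * A ^ (k + m) * (∑ i, x i) ^ k := by
  rw [Finset.sum_pow_eq_sum_piAntidiag, Finset.mul_sum]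
  refine Finset.sum_congr rfl fun α hα => ?_
  have hk : ∑ i, α i = k := (Finset.mem_piAntidiag.1 hα).1
  have hs := Nat.multinomial_spec (Finset.univ : Finset (Fin m)) α
  rw [hk] at hs
  have hs' : ((∏ i, (α i).factorial : ℕ) : ℝ) * (Nat.multinomial Finset.univ α : ℝ)
      = (k.factorial : ℝ) := by exact_mod_cast hs
  have hne : ((∏ i, (α i).factorial : ℕ) : ℝ) ≠ 0 := by
    exact_mod_cast (Finset.prod_pos fun i _ => Nat.factorial_pos (α i)).ne'
  unfold majTerm
  rw [hk, prod_shift_eq, ← hs']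
  field_simp

lemma summable_g (n m : ℕ) (A X : ℝ) (hA : 0 ≤ A) (hX : 0 ≤ X) (h : A * X < 1) :
    Summable fun k : ℕ =>
      ((m + k).choose k : ℝ) * ((k : ℝ) + m) ^ n * A ^ (k + m) * X ^ k := by
  set y : ℝ := (A * X + 1) / 2 with hy
  have hAX : 0 ≤ A * X := mul_nonneg hA hX
  have hy0 : 0 < y := by linarith
  have hy1 : y < 1 := by linarith
  have hs := summable_pow_mul_geometric_of_norm_lt_one (R := ℝ) (m + n) (r := y)
    (by rw [Real.norm_of_nonneg hy0.le]; exact hy1)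
  have hs2 := ((summable_nat_add_iff m).2 hs).mul_left (A ^ m * (y ^ m)⁻¹)
  refine Summable.of_nonneg_of_le (fun k => by positivity) (fun k => ?_) hs2
  have h1 : ((m + k).choose k : ℝ) ≤ ((k : ℝ) + m) ^ m := by
    rw [Nat.choose_symm_add.symm]
    have := Nat.choose_le_pow (m + k) m
    have h2 : (m + k).choose m ≤ (k + m) ^ m := by
      refine le_trans (Nat.choose_le_descFactorial _ _) ?_
      rw [add_comm k m]; exact Nat.descFactorial_le_pow _ _
    exact_mod_cast h2
  have h3 : (A * X) ^ k ≤ y ^ k := pow_le_pow_left₀ hAX (by linarith) k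
  calc ((m + k).choose k : ℝ) * ((k : ℝ) + m) ^ n * A ^ (k + m) * X ^ k
      = (((m + k).choose k : ℝ) * ((k : ℝ) + m) ^ n) * A ^ m * (A * X) ^ k := by ring
    _ ≤ (((k : ℝ) + m) ^ m * ((k : ℝ) + m) ^ n) * A ^ m * y ^ k := by gcongr
    _ = _ := by
      push_cast
      rw [pow_add y]
      field_simp
      ring

lemma majTerm_nonneg (n m : ℕ) (A : ℝ) (hA : 0 ≤ A) (x : Fin m → ℝ) (hx : ∀ i, 0 ≤ x i)
    (α : Fin m → ℕ) : 0 ≤ majTerm n m A x α := by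
  unfold majTerm
  have : 0 ≤ ∏ i, (x i) ^ (α i) := Finset.prod_nonneg fun i _ => pow_nonneg (hx i) _
  have : 0 ≤ ∏ j ∈ Finset.range (∑ i, α i), ((m : ℝ) + 1 + (j : ℝ)) :=
    Finset.prod_nonneg fun i _ => by positivity
  positivity

lemma summable_majTerm (n m : ℕ) (A : ℝ) (hA : 0 ≤ A) (x : Fin m → ℝ) (hx : ∀ i, 0 ≤ x i)
    (h : A * ∑ i, x i < 1) : Summable (majTerm n m A x) := by
  have hX : 0 ≤ ∑ i, x i := Finset.sum_nonneg fun i _ => hx i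
  have hg := summable_g n m A _ hA hX h
  refine summable_of_sum_le (fun α => majTerm_nonneg n m A hA x hx α)
    (c := ∑' k : ℕ, ((m + k).choose k : ℝ) * ((k : ℝ) + m) ^ n * A ^ (k + m) * (∑ i, x i) ^ k)
    fun S => ?_
  classical
  rw [← Finset.sum_fiberwise_of_maps_to (s := S) (t := S.image fun α => ∑ i, α i)
    (g := fun α => ∑ i, α i) (fun α hα => Finset.mem_image_of_mem _ hα)]
  refine le_trans (Finset.sum_le_sum fun k _ => ?_)
    (hg.sum_le_tsum _ fun k _ => by positivity)
  rw [← sum_majTerm]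
  refine Finset.sum_le_sum_of_subset_of_nonneg (fun α hα => ?_)
    fun α _ _ => majTerm_nonneg n m A hA x hx α
  simp only [Finset.mem_filter] at hα
  simp [hα.2]

lemma norm_bergmanTerm_le (n m : ℕ) (μ : ℝ) (hμ : 0 < μ)
    (z : EuclideanSpace ℂ (Fin n)) (w : EuclideanSpace ℂ (Fin m))
    (t : EuclideanSpace ℂ (Fin n)) (s : EuclideanSpace ℂ (Fin m))
    (a : ℝ) (b : Fin m → ℝ) (ha : ‖z‖ ≤ a) (hb : ∀ i, ‖w i‖ ≤ b i) (α : Fin m → ℕ) :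
    ‖bergmanTerm n m μ z w t s α‖ ≤
      majTerm n m (Real.exp (μ * a * ‖t‖)) (fun i => b i * ‖s i‖) α := by
  unfold bergmanTerm majTerm
  have e1 : ‖∏ j ∈ Finset.range (∑ i, α i), ((m : ℂ) + 1 + (j : ℂ))‖ =
      ∏ j ∈ Finset.range (∑ i, α i), ((m : ℝ) + 1 + (j : ℝ)) := by
    rw [norm_prod]
    refine Finset.prod_congr rfl fun j _ => ?_
    have : ((m : ℂ) + 1 + (j : ℂ)) = ((m + 1 + j : ℕ) : ℂ) := by push_cast; ring
    rw [this, Complex.norm_natCast]; push_cast; ring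
  have e2 : ‖(((∑ i, α i : ℕ) : ℂ) + (m : ℂ))‖ = ((∑ i, α i : ℕ) : ℝ) + (m : ℝ) := by
    rw [← Nat.cast_add, Complex.norm_natCast, Nat.cast_add]
  have e3 : ‖Complex.exp ((μ : ℂ) * (((∑ i, α i : ℕ) : ℂ) + (m : ℂ)) *
      ∑ j, z j * (starRingEnd ℂ) (t j))‖ ≤ Real.exp (μ * a * ‖t‖) ^ ((∑ i, α i) + m) := by
    rw [Complex.norm_exp, ← Real.exp_nat_mul]
    apply Real.exp_le_exp.2
    refine le_trans (Complex.re_le_norm _) ?_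
    rw [norm_mul, norm_mul, e2, Complex.norm_real, Real.norm_of_nonneg hμ.le]
    have hin : ‖∑ j, z j * (starRingEnd ℂ) (t j)‖ ≤ a * ‖t‖ := by
      have h1 : ∑ j, z j * (starRingEnd ℂ) (t j) = inner ℂ t z := by
        simp [PiLp.inner_apply]
      rw [h1]
      refine le_trans (norm_inner_le_norm t z) ?_
      rw [mul_comm]; gcongr
    calc _ ≤ μ * (((∑ i, α i : ℕ) : ℝ) + (m : ℝ)) * (a * ‖t‖) := by gcongr
      _ = _ := by push_cast; ring
  have e4 : ‖∏ i, (w i) ^ (α i)‖ * ‖∏ i, ((starRingEnd ℂ) (s i)) ^ (α i)‖ ≤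
      ∏ i, (b i * ‖s i‖) ^ (α i) := by
    rw [norm_prod, norm_prod, ← Finset.prod_mul_distrib]
    refine Finset.prod_le_prod (fun i _ => by positivity) fun i _ => ?_
    rw [norm_pow, norm_pow, RCLike.norm_conj, ← mul_pow]
    have := hb i
    gcongr
  rw [norm_mul, norm_mul, norm_mul, norm_div, norm_mul, norm_pow, e1, e2, Complex.norm_natCast,
    mul_assoc]
  have : 0 ≤ ∏ j ∈ Finset.range (∑ i, α i), ((m : ℝ) + 1 + (j : ℝ)) :=
    Finset.prod_nonneg fun i _ => by positivity
  gcongr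

lemma norm_fderiv_le_of_bound {V : Type*} [NormedAddCommGroup V] [NormedSpace ℂ V]
    (f : V → ℂ) (hf : Differentiable ℂ f) (x : V) (δ C : ℝ) (hδ : 0 < δ)
    (hC : ∀ y, ‖y - x‖ ≤ δ → ‖f y‖ ≤ C) : ‖fderiv ℂ f x‖ ≤ C / δ := by
  have hC0 : 0 ≤ C := le_trans (norm_nonneg _) (hC x (by simpa using hδ.le))
  refine ContinuousLinearMap.opNorm_le_bound _ (by positivity) fun v => ?_
  rcases eq_or_ne v 0 with rfl | hv
  · simp
  have hv' : 0 < ‖v‖ := norm_pos_iff.2 hv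
  have hl : HasDerivAt (fun ζ : ℂ => x + ζ • v) v 0 := by
    simpa using ((hasDerivAt_id (0 : ℂ)).smul_const v).const_add x
  have hd : HasDerivAt (fun ζ : ℂ => f (x + ζ • v)) (fderiv ℂ f x v) 0 := by
    have h0 : HasFDerivAt f (fderiv ℂ f x) (x + (0 : ℂ) • v) := by
      simpa using (hf x).hasFDerivAt
    exact h0.comp_hasDerivAt (0 : ℂ) hl
  have hdiff : Differentiable ℂ (fun ζ : ℂ => f (x + ζ • v)) := by
    fun_prop
  have := Complex.norm_deriv_le_of_forall_mem_sphere_norm_le (c := (0 : ℂ)) (R := δ / ‖v‖) (C := C)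
    (f := fun ζ : ℂ => f (x + ζ • v)) (by positivity) hdiff.diffContOnCl (fun ζ hζ => by
      apply hC
      rw [mem_sphere_zero_iff_norm] at hζ
      rw [add_sub_cancel_left, norm_smul, hζ]
      field_simp; exact le_refl _)
  rw [hd.deriv] at this
  refine this.trans (le_of_eq ?_)
  field_simp

lemma differentiable_bergmanTerm (n m : ℕ) (μ : ℝ)
    (q : EuclideanSpace ℂ (Fin n) × EuclideanSpace ℂ (Fin m)) (α : Fin m → ℕ) :
    Differentiable ℂ (fun p : EuclideanSpace ℂ (Fin n) × EuclideanSpace ℂ (Fin m) =>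
      bergmanTerm n m μ p.1 p.2 q.1 q.2 α) := by
  unfold bergmanTerm
  have h1 : ∀ j, Differentiable ℂ
      (fun p : EuclideanSpace ℂ (Fin n) × EuclideanSpace ℂ (Fin m) => p.1 j) := fun j => by fun_prop
  have h2 : ∀ j, Differentiable ℂ
      (fun p : EuclideanSpace ℂ (Fin n) × EuclideanSpace ℂ (Fin m) => p.2 j) := fun j => by fun_prop
  fun_prop

lemma main_local (n m : ℕ) (μ : ℝ) (hμ : 0 < μ)
    (p q : EuclideanSpace ℂ (Fin n) × EuclideanSpace ℂ (Fin m))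
    (h : Real.exp (μ * ‖p.1‖ * ‖q.1‖) * (‖p.2‖ * ‖q.2‖) < 1) :
    Summable (fun α : Fin m → ℕ => ‖bergmanTerm n m μ p.1 p.2 q.1 q.2 α‖) ∧
    DifferentiableAt ℂ (fun p => bergmanKernel n m μ p q) p := by
  have hcs : ∑ i, ‖p.2 i‖ * ‖q.2 i‖ ≤ ‖p.2‖ * ‖q.2‖ := by
    rw [EuclideanSpace.norm_eq, EuclideanSpace.norm_eq]
    exact Real.sum_mul_le_sqrt_mul_sqrt _ _ _
  have h0 : Real.exp (μ * (‖p.1‖ + 0) * ‖q.1‖) * ∑ i, (‖p.2 i‖ + 0) * ‖q.2 i‖ < 1 := by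
    simp only [add_zero]
    exact lt_of_le_of_lt (by gcongr) h
  obtain ⟨ε, hε, hε1⟩ : ∃ ε : ℝ, 0 < ε ∧
      Real.exp (μ * (‖p.1‖ + ε) * ‖q.1‖) * ∑ i, (‖p.2 i‖ + ε) * ‖q.2 i‖ < 1 := by
    have hc : Continuous fun ε : ℝ =>
        Real.exp (μ * (‖p.1‖ + ε) * ‖q.1‖) * ∑ i, (‖p.2 i‖ + ε) * ‖q.2 i‖ := by fun_prop
    have hev := (hc.continuousAt (x := 0)).eventually_lt continuousAt_const h0
    have hev2 : ∀ᶠ ε in nhdsWithin (0 : ℝ) (Set.Ioi 0), 0 < ε ∧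
      Real.exp (μ * (‖p.1‖ + ε) * ‖q.1‖) * ∑ i, (‖p.2 i‖ + ε) * ‖q.2 i‖ < 1 := by
      filter_upwards [self_mem_nhdsWithin, hev.filter_mono nhdsWithin_le_nhds] with ε h1 h2
      exact ⟨h1, h2⟩
    exact hev2.exists
  set u := majTerm n m (Real.exp (μ * (‖p.1‖ + ε) * ‖q.1‖))
    (fun i => (‖p.2 i‖ + ε) * ‖q.2 i‖) with hu
  have hus : Summable u := summable_majTerm n m _ (Real.exp_pos _).le _
    (fun i => by positivity) hε1
  have hbound : ∀ α, ∀ y : EuclideanSpace ℂ (Fin n) × EuclideanSpace ℂ (Fin m), ‖y - p‖ ≤ ε →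
      ‖bergmanTerm n m μ y.1 y.2 q.1 q.2 α‖ ≤ u α := by
    intro α y hy
    have hy1 : ‖y.1 - p.1‖ ≤ ε := (norm_fst_le (y - p)).trans hy
    have hy2 : ‖y.2 - p.2‖ ≤ ε := (norm_snd_le (y - p)).trans hy
    refine norm_bergmanTerm_le n m μ hμ _ _ _ _ _ (fun i => ‖p.2 i‖ + ε) ?_ (fun i => ?_) α
    · have := norm_le_norm_add_norm_sub' y.1 p.1
      linarith
    · have h3 := norm_le_norm_add_norm_sub' (y.2 i) (p.2 i)
      have h4 : ‖y.2 i - p.2 i‖ ≤ ‖y.2 - p.2‖ := PiLp.norm_apply_le (y.2 - p.2) i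
      linarith
  have hsum : Summable (fun α : Fin m → ℕ => ‖bergmanTerm n m μ p.1 p.2 q.1 q.2 α‖) :=
    Summable.of_nonneg_of_le (fun _ => norm_nonneg _)
      (fun α => hbound α p (by simpa using hε.le)) hus
  refine ⟨hsum, ?_⟩
  have hp : p ∈ Metric.ball p (ε / 2) := Metric.mem_ball_self (by positivity)
  have hder := hasFDerivAt_tsum_of_isPreconnected (𝕜 := ℂ) (u := fun α => u α / (ε / 2))
    (f := fun α (y : EuclideanSpace ℂ (Fin n) × EuclideanSpace ℂ (Fin m)) =>
      bergmanTerm n m μ y.1 y.2 q.1 q.2 α)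
    (f' := fun α y => fderiv ℂ (fun y : EuclideanSpace ℂ (Fin n) × EuclideanSpace ℂ (Fin m) =>
      bergmanTerm n m μ y.1 y.2 q.1 q.2 α) y)
    (hus.div_const _) Metric.isOpen_ball
    (letI : NormedSpace ℝ (EuclideanSpace ℂ (Fin n) × EuclideanSpace ℂ (Fin m)) :=
      NormedSpace.restrictScalars ℝ ℂ _
     (convex_ball p (ε / 2)).isPreconnected)
    (fun α y _ => (differentiable_bergmanTerm n m μ q α y).hasFDerivAt)
    (fun α y hy => norm_fderiv_le_of_bound _ (differentiable_bergmanTerm n m μ q α) y _ _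
      (by positivity) fun y' hy' => hbound α y' (by
        rw [Metric.mem_ball, dist_eq_norm] at hy
        have := norm_sub_le_norm_sub_add_norm_sub y' y p
        linarith))
    hp hsum.of_norm hp
  unfold bergmanKernel
  exact hder.differentiableAt.const_mul _

lemma main_r (n m : ℕ) (μ : ℝ) (hμ : 0 < μ)
    (E : Set (EuclideanSpace ℂ (Fin n) × EuclideanSpace ℂ (Fin m)))
    (r : ℝ) (hr0 : 0 < r) (hr1 : r < 1)
    (hE : E ⊆ {p : EuclideanSpace ℂ (Fin n) × EuclideanSpace ℂ (Fin m) |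
        ‖p.2‖ ^ 2 < r ^ 2 * Real.exp (-μ * ‖p.1‖ ^ 2)}) :
      (IsOpen {p : EuclideanSpace ℂ (Fin n) × EuclideanSpace ℂ (Fin m) |
          ‖p.2‖ ^ 2 < r⁻¹ ^ 2 * Real.exp (-μ * ‖p.1‖ ^ 2)} ∧
        closure (FBH n m μ) ⊆
          {p | ‖p.2‖ ^ 2 < r⁻¹ ^ 2 * Real.exp (-μ * ‖p.1‖ ^ 2)} ∧
        ∀ q ∈ E,
          (∀ p ∈ {p : EuclideanSpace ℂ (Fin n) × EuclideanSpace ℂ (Fin m) |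
              ‖p.2‖ ^ 2 < r⁻¹ ^ 2 * Real.exp (-μ * ‖p.1‖ ^ 2)},
            Summable (fun α : Fin m → ℕ =>
              ‖bergmanTerm n m μ p.1 p.2 q.1 q.2 α‖)) ∧
          DifferentiableOn ℂ (fun p => bergmanKernel n m μ p q)
            {p | ‖p.2‖ ^ 2 < r⁻¹ ^ 2 * Real.exp (-μ * ‖p.1‖ ^ 2)}) := by
  refine ⟨isOpen_lt (by fun_prop) (by fun_prop), ?_, ?_⟩
  · intro p hp
    have hcl : IsClosed {p : EuclideanSpace ℂ (Fin n) × EuclideanSpace ℂ (Fin m) |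
        ‖p.2‖ ^ 2 ≤ Real.exp (-μ * ‖p.1‖ ^ 2)} := isClosed_le (by fun_prop) (by fun_prop)
    have hsub : FBH n m μ ⊆ {p : EuclideanSpace ℂ (Fin n) × EuclideanSpace ℂ (Fin m) |
        ‖p.2‖ ^ 2 ≤ Real.exp (-μ * ‖p.1‖ ^ 2)} := by
      intro p hp
      have h0 : ‖p.2‖ ^ 2 < Real.exp (-μ * ‖p.1‖ ^ 2) := hp
      exact h0.le
    have h1 : ‖p.2‖ ^ 2 ≤ Real.exp (-μ * ‖p.1‖ ^ 2) := closure_minimal hsub hcl hp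
    have h2 : 1 < r⁻¹ ^ 2 := one_lt_pow₀ ((one_lt_inv₀ hr0).2 hr1) (by norm_num)
    have h3 := Real.exp_pos (-μ * ‖p.1‖ ^ 2)
    show ‖p.2‖ ^ 2 < r⁻¹ ^ 2 * Real.exp (-μ * ‖p.1‖ ^ 2)
    nlinarith
  · intro q hq
    have key : ∀ p ∈ {p : EuclideanSpace ℂ (Fin n) × EuclideanSpace ℂ (Fin m) |
        ‖p.2‖ ^ 2 < r⁻¹ ^ 2 * Real.exp (-μ * ‖p.1‖ ^ 2)},
        Real.exp (μ * ‖p.1‖ * ‖q.1‖) * (‖p.2‖ * ‖q.2‖) < 1 := by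
      intro p hp
      have hp' : ‖p.2‖ ^ 2 < r⁻¹ ^ 2 * Real.exp (-μ * ‖p.1‖ ^ 2) := hp
      have hq' : ‖q.2‖ ^ 2 < r ^ 2 * Real.exp (-μ * ‖q.1‖ ^ 2) := hE hq
      have h1 : ‖p.2‖ ^ 2 * ‖q.2‖ ^ 2 <
          (r⁻¹ ^ 2 * Real.exp (-μ * ‖p.1‖ ^ 2)) * (r ^ 2 * Real.exp (-μ * ‖q.1‖ ^ 2)) :=
        mul_lt_mul'' hp' hq' (by positivity) (by positivity)
      have h2 : (r⁻¹ ^ 2 * Real.exp (-μ * ‖p.1‖ ^ 2)) * (r ^ 2 * Real.exp (-μ * ‖q.1‖ ^ 2)) =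
          Real.exp (-μ * ‖p.1‖ ^ 2 + -μ * ‖q.1‖ ^ 2) := by
        rw [Real.exp_add]; field_simp
      rw [h2] at h1
      have h4 : (Real.exp (μ * ‖p.1‖ * ‖q.1‖) * (‖p.2‖ * ‖q.2‖)) ^ 2 < 1 := by
        calc (Real.exp (μ * ‖p.1‖ * ‖q.1‖) * (‖p.2‖ * ‖q.2‖)) ^ 2
            = Real.exp (μ * ‖p.1‖ * ‖q.1‖) ^ 2 * (‖p.2‖ ^ 2 * ‖q.2‖ ^ 2) := by ring
          _ < Real.exp (μ * ‖p.1‖ * ‖q.1‖) ^ 2 *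
              Real.exp (-μ * ‖p.1‖ ^ 2 + -μ * ‖q.1‖ ^ 2) := by gcongr
          _ = Real.exp (-(μ * (‖p.1‖ - ‖q.1‖) ^ 2)) := by
            rw [← Real.exp_nat_mul, ← Real.exp_add]; congr 1; push_cast; ring
          _ ≤ 1 := by
            rw [Real.exp_le_one_iff]
            have : 0 ≤ μ * (‖p.1‖ - ‖q.1‖) ^ 2 := by positivity
            linarith
      exact (sq_lt_one_iff₀ (by positivity)).1 h4
    exact ⟨fun p hp => (main_local n m μ hμ p q (key p hp)).1,
      fun p hp => (main_local n m μ hμ p q (key p hp)).2.differentiableWithinAt⟩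

lemma exists_r (n m : ℕ) (μ : ℝ)
    (E : Set (EuclideanSpace ℂ (Fin n) × EuclideanSpace ℂ (Fin m)))
    (hEcompact : IsCompact E) (hEsub : E ⊆ FBH n m μ) :
    ∃ r : ℝ, 0 < r ∧ r < 1 ∧ E ⊆ {p : EuclideanSpace ℂ (Fin n) × EuclideanSpace ℂ (Fin m) |
        ‖p.2‖ ^ 2 < r ^ 2 * Real.exp (-μ * ‖p.1‖ ^ 2)} := by
  rcases E.eq_empty_or_nonempty with rfl | hne
  · exact ⟨1 / 2, by norm_num, by norm_num, Set.empty_subset _⟩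
  obtain ⟨p₀, hp₀, hmax⟩ := hEcompact.exists_isMaxOn hne
    (f := fun p => ‖p.2‖ ^ 2 * Real.exp (μ * ‖p.1‖ ^ 2)) (by fun_prop)
  set c := ‖p₀.2‖ ^ 2 * Real.exp (μ * ‖p₀.1‖ ^ 2) with hc
  have hexp : ∀ x : ℝ, Real.exp (-μ * x) * Real.exp (μ * x) = 1 := fun x => by
    rw [← Real.exp_add]; simp
  have hc0 : 0 ≤ c := by positivity
  have hc1 : c < 1 := by
    have h1 : ‖p₀.2‖ ^ 2 < Real.exp (-μ * ‖p₀.1‖ ^ 2) := hEsub hp₀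
    rw [← hexp (‖p₀.1‖ ^ 2), hc]
    gcongr
  refine ⟨Real.sqrt ((1 + c) / 2), Real.sqrt_pos.2 (by linarith), ?_, fun p hp => ?_⟩
  · rw [Real.sqrt_lt' one_pos]; linarith
  · show ‖p.2‖ ^ 2 < Real.sqrt ((1 + c) / 2) ^ 2 * Real.exp (-μ * ‖p.1‖ ^ 2)
    rw [Real.sq_sqrt (by linarith)]
    have h1 : ‖p.2‖ ^ 2 * Real.exp (μ * ‖p.1‖ ^ 2) ≤ c := hmax hp
    have h2 := Real.exp_pos (-μ * ‖p.1‖ ^ 2)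
    calc ‖p.2‖ ^ 2 = (‖p.2‖ ^ 2 * Real.exp (μ * ‖p.1‖ ^ 2)) * Real.exp (-μ * ‖p.1‖ ^ 2) := by
          rw [mul_assoc, mul_comm (Real.exp _), hexp, mul_one]
      _ ≤ c * Real.exp (-μ * ‖p.1‖ ^ 2) := by gcongr
      _ < _ := by
        apply mul_lt_mul_of_pos_right _ h2
        linarith

/-- Semi-regularity at the boundary of the Bergman kernel of `D_{n,m}(μ)`:
for every compact `E ⊆ D_{n,m}(μ)` there is an open set `G` containing the
closure of `D_{n,m}(μ)` such that for each `(t,s) ∈ E` the kernel series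
converges absolutely at every point of `G` and `(z,w) ↦ K((z,w),(t,s))` is
holomorphic on `G`; in fact one may take
`G = {(z,w) : ‖w‖² < r⁻² exp(−μ‖z‖²)}` whenever `0 < r < 1` and
`E ⊆ {(z,w) : ‖w‖² < r² exp(−μ‖z‖²)}`. -/
theorem bergman_kernel_semi_regularity
    (n m : ℕ) (hn : 0 < n) (hm : 0 < m) (μ : ℝ) (hμ : 0 < μ)
    (E : Set (EuclideanSpace ℂ (Fin n) × EuclideanSpace ℂ (Fin m)))
    (hEcompact : IsCompact E) (hEsub : E ⊆ FBH n m μ) :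
    (∃ G : Set (EuclideanSpace ℂ (Fin n) × EuclideanSpace ℂ (Fin m)),
      IsOpen G ∧ closure (FBH n m μ) ⊆ G ∧
      ∀ q ∈ E,
        (∀ p ∈ G, Summable (fun α : Fin m → ℕ =>
          ‖bergmanTerm n m μ p.1 p.2 q.1 q.2 α‖)) ∧
        DifferentiableOn ℂ (fun p => bergmanKernel n m μ p q) G) ∧
    ∀ r : ℝ, 0 < r → r < 1 →
      E ⊆ {p : EuclideanSpace ℂ (Fin n) × EuclideanSpace ℂ (Fin m) |
        ‖p.2‖ ^ 2 < r ^ 2 * Real.exp (-μ * ‖p.1‖ ^ 2)} →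
      (IsOpen {p : EuclideanSpace ℂ (Fin n) × EuclideanSpace ℂ (Fin m) |
          ‖p.2‖ ^ 2 < r⁻¹ ^ 2 * Real.exp (-μ * ‖p.1‖ ^ 2)} ∧
        closure (FBH n m μ) ⊆
          {p | ‖p.2‖ ^ 2 < r⁻¹ ^ 2 * Real.exp (-μ * ‖p.1‖ ^ 2)} ∧
        ∀ q ∈ E,
          (∀ p ∈ {p : EuclideanSpace ℂ (Fin n) × EuclideanSpace ℂ (Fin m) |
              ‖p.2‖ ^ 2 < r⁻¹ ^ 2 * Real.exp (-μ * ‖p.1‖ ^ 2)},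
            Summable (fun α : Fin m → ℕ =>
              ‖bergmanTerm n m μ p.1 p.2 q.1 q.2 α‖)) ∧
          DifferentiableOn ℂ (fun p => bergmanKernel n m μ p q)
            {p | ‖p.2‖ ^ 2 < r⁻¹ ^ 2 * Real.exp (-μ * ‖p.1‖ ^ 2)}) := by
  
  obtain ⟨r, hr0, hr1, hE⟩ := exists_r n m μ E hEcompact hEsub
  exact ⟨⟨_, main_r n m μ hμ E r hr0 hr1 hE⟩, fun r h0 h1 h2 => main_r n m μ hμ E r h0 h1 h2⟩
end

section
/- Let n, m be positive integers and μ > 0. For all points (z,w) and (t,s) of the Fock–Bargmann–Hartogs domain D_{n,m}(μ), the family indexed by multi-indices α ∈ ℕ^m with terms [ (m+1)_{|α|} (|α|+m)^n / α! ] · e^{μ(|α|+m)⟨z,t⟩} · w^α · conj(s)^α is (absolutely) summable in ℂ. -/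
open scoped BigOperators

lemma fbh_summable_poly_geom (N m : ℕ) (r : ℝ) (h0 : 0 ≤ r) (h1 : r < 1) :
    Summable (fun k : ℕ => ((k : ℝ) + m) ^ N * r ^ k) := by
  have hA : Summable (fun k : ℕ => (k : ℝ) ^ N * r ^ k) :=
    summable_pow_mul_geometric_of_norm_lt_one N (by rwa [Real.norm_of_nonneg h0])
  have hB : Summable (fun k : ℕ => r ^ k) := summable_geometric_of_lt_one h0 h1
  refine Summable.of_nonneg_of_le (fun k => by positivity) (fun k => ?_)
    ((hA.add (hB.mul_left ((m : ℝ) ^ N))).mul_left ((2 : ℝ) ^ (N - 1)))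
  have := add_pow_le (Nat.cast_nonneg (α := ℝ) k) (Nat.cast_nonneg (α := ℝ) m) N
  calc ((k : ℝ) + m) ^ N * r ^ k
      ≤ (2 ^ (N - 1) * ((k : ℝ) ^ N + (m : ℝ) ^ N)) * r ^ k := by gcongr
    _ = _ := by ring

/-- Summability of a family on multi-indices, grouped by total degree. -/
lemma fbh_summable_multi (m : ℕ) (a : ℕ → ℝ) (ha : ∀ k, 0 ≤ a k) (x : Fin m → ℝ)
    (hx : ∀ i, 0 ≤ x i) (hs : Summable (fun k => a k * (∑ i, x i) ^ k)) :
    Summable (fun α : Fin m → ℕ => a (∑ i, α i) *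
      ((Nat.multinomial Finset.univ α : ℝ) * ∏ i, x i ^ α i)) := by
  have hS : 0 ≤ ∑ i, x i := Finset.sum_nonneg fun i _ => hx i
  have hnn : ∀ α : Fin m → ℕ, 0 ≤ (Nat.multinomial Finset.univ α : ℝ) * ∏ i, x i ^ α i :=
    fun α => mul_nonneg (Nat.cast_nonneg _) (Finset.prod_nonneg fun i _ => pow_nonneg (hx i) _)
  refine summable_of_sum_le (c := ∑' k, a k * (∑ i, x i) ^ k)
    (fun α => mul_nonneg (ha _) (hnn α)) (fun u => ?_)
  rw [← Finset.sum_fiberwise_of_maps_to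
    (t := u.image (fun α => ∑ i, α i)) (g := fun α : Fin m → ℕ => ∑ i, α i)
    (fun α h => Finset.mem_image_of_mem _ h)]
  refine le_trans (Finset.sum_le_sum fun k _ => ?_)
    (hs.sum_le_tsum _ (fun k _ => mul_nonneg (ha k) (pow_nonneg hS k)))
  rw [Finset.sum_pow_eq_sum_piAntidiag, Finset.mul_sum]
  calc _ = ∑ α ∈ u with ∑ i, α i = k, a k *
      ((Nat.multinomial Finset.univ α : ℝ) * ∏ i, x i ^ α i) := by
        refine Finset.sum_congr rfl fun α h => ?_
        rw [(Finset.mem_filter.1 h).2]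
    _ ≤ _ := by
        refine Finset.sum_le_sum_of_subset_of_nonneg ?_ (fun α _ _ => mul_nonneg (ha _) (hnn α))
        intro α h
        simp [(Finset.mem_filter.1 h).2]

lemma fbh_re_le (n : ℕ) (z t : EuclideanSpace ℂ (Fin n)) :
    (∑ j, z j * (starRingEnd ℂ) (t j)).re ≤ (‖z‖ ^ 2 + ‖t‖ ^ 2) / 2 := by
  rw [EuclideanSpace.norm_sq_eq, EuclideanSpace.norm_sq_eq, ← Finset.sum_add_distrib,
    Finset.sum_div, Complex.re_sum]
  refine Finset.sum_le_sum fun j _ => ?_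
  have h := Complex.re_le_norm (z j * (starRingEnd ℂ) (t j))
  rw [norm_mul, RCLike.norm_conj] at h
  nlinarith [sq_nonneg (‖z j‖ - ‖t j‖)]

lemma fbh_sum_le (m : ℕ) (w s : EuclideanSpace ℂ (Fin m)) :
    ∑ i, ‖w i‖ * ‖s i‖ ≤ ‖w‖ * ‖s‖ := by
  rw [EuclideanSpace.norm_eq, EuclideanSpace.norm_eq]
  exact Real.sum_mul_le_sqrt_mul_sqrt _ _ _

lemma fbh_ratio_lt (n m : ℕ) (μ : ℝ) (hμ : 0 < μ)
    (p q : EuclideanSpace ℂ (Fin n) × EuclideanSpace ℂ (Fin m))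
    (hp : p ∈ FBH n m μ) (hq : q ∈ FBH n m μ) :
    Real.exp (μ * (∑ j, p.1 j * (starRingEnd ℂ) (q.1 j)).re) *
      ∑ i, ‖p.2 i‖ * ‖q.2 i‖ < 1 := by
  have h1 : ‖p.2‖ ^ 2 < Real.exp (-μ * ‖p.1‖ ^ 2) := hp
  have h2 : ‖q.2‖ ^ 2 < Real.exp (-μ * ‖q.1‖ ^ 2) := hq
  have hre := fbh_re_le n p.1 q.1
  have hsum := fbh_sum_le m p.2 q.2
  set R := (∑ j, p.1 j * (starRingEnd ℂ) (q.1 j)).re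
  have h3 : ‖p.2‖ * ‖q.2‖ < Real.exp (-μ * ((‖p.1‖ ^ 2 + ‖q.1‖ ^ 2) / 2)) := by
    refine lt_of_pow_lt_pow_left₀ 2 (Real.exp_pos _).le ?_
    rw [← Real.exp_nat_mul, mul_pow]
    calc ‖p.2‖ ^ 2 * ‖q.2‖ ^ 2 < Real.exp (-μ * ‖p.1‖ ^ 2) * Real.exp (-μ * ‖q.1‖ ^ 2) :=
          mul_lt_mul'' h1 h2 (by positivity) (by positivity)
      _ = _ := by rw [← Real.exp_add]; congr 1; push_cast; ring
  calc Real.exp (μ * R) * ∑ i, ‖p.2 i‖ * ‖q.2 i‖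
      ≤ Real.exp (μ * R) * (‖p.2‖ * ‖q.2‖) := by gcongr
    _ < Real.exp (μ * R) * Real.exp (-μ * ((‖p.1‖ ^ 2 + ‖q.1‖ ^ 2) / 2)) := by gcongr
    _ ≤ 1 := by
      rw [← Real.exp_add, Real.exp_le_one_iff]
      nlinarith

lemma fbh_norm_term (n m : ℕ) (μ : ℝ)
    (z : EuclideanSpace ℂ (Fin n)) (w : EuclideanSpace ℂ (Fin m))
    (t : EuclideanSpace ℂ (Fin n)) (s : EuclideanSpace ℂ (Fin m)) (α : Fin m → ℕ) (E : ℝ)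
    (hE : E = Real.exp (μ * (∑ j, z j * (starRingEnd ℂ) (t j)).re)) :
    ‖bergmanTerm n m μ z w t s α‖ =
      (((m + ∑ i, α i).choose (∑ i, α i) : ℝ) * (((∑ i, α i : ℕ) : ℝ) + m) ^ n * E ^ m) *
      ((Nat.multinomial Finset.univ α : ℝ) * ∏ i, (E * (‖w i‖ * ‖s i‖)) ^ α i) := by
  have hspec : ((∏ i, (α i).factorial : ℕ) : ℝ) * (Nat.multinomial Finset.univ α : ℝ)
      = ((∑ i, α i).factorial : ℝ) := by
    exact_mod_cast Nat.multinomial_spec Finset.univ α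
  have hf : ((∏ i, (α i).factorial : ℕ) : ℝ) ≠ 0 := by
    exact_mod_cast (Finset.prod_pos fun i _ => Nat.factorial_pos (α i)).ne'
  have hprod : ∏ i, (E * (‖w i‖ * ‖s i‖)) ^ α i
      = E ^ (∑ i, α i) * ((∏ i, ‖w i‖ ^ α i) * ∏ i, ‖s i‖ ^ α i) := by
    simp only [mul_pow, Finset.prod_mul_distrib, Finset.prod_pow_eq_pow_sum]
  have hpoch : (∏ j ∈ Finset.range (∑ i, α i), ((m : ℂ) + 1 + (j : ℂ)))
      = (((∑ i, α i).factorial * (m + ∑ i, α i).choose (∑ i, α i) : ℕ) : ℂ) := by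
    rw [← Nat.ascFactorial_eq_factorial_mul_choose, Nat.ascFactorial_eq_prod_range]
    push_cast
    rfl
  unfold bergmanTerm
  rw [hpoch, hprod]
  generalize (∑ i, α i) = k at *
  have hexp : ‖Complex.exp ((μ : ℂ) * ((k : ℂ) + (m : ℂ)) *
      ∑ j, z j * (starRingEnd ℂ) (t j))‖ = E ^ (k + m) := by
    rw [Complex.norm_exp, hE, ← Real.exp_nat_mul]
    congr 1
    have : (μ : ℂ) * ((k : ℂ) + (m : ℂ)) = ((μ * (k + m) : ℝ) : ℂ) := by push_cast; rfl
    rw [this, Complex.re_ofReal_mul]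
    push_cast
    ring
  have hkm : ‖(k : ℂ) + (m : ℂ)‖ = (k : ℝ) + m := by
    rw [← Nat.cast_add, Complex.norm_natCast, Nat.cast_add]
  simp only [norm_mul, norm_div, norm_pow, norm_prod, hexp, hkm, RCLike.norm_conj,
    Complex.norm_natCast]
  rw [Nat.cast_mul, ← hspec, pow_add]
  field_simp

/-- For all points `(z,w)` and `(t,s)` of `D_{n,m}(μ)`, the family of terms of
the Bergman kernel series, indexed by multi-indices `α ∈ ℕ^m`, is (absolutely)
summable in `ℂ`. -/
theorem bergman_kernel_terms_summable
    (n m : ℕ) (hn : 0 < n) (hm : 0 < m) (μ : ℝ) (hμ : 0 < μ)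
    (p q : EuclideanSpace ℂ (Fin n) × EuclideanSpace ℂ (Fin m))
    (hp : p ∈ FBH n m μ) (hq : q ∈ FBH n m μ) :
    Summable (fun α : Fin m → ℕ => bergmanTerm n m μ p.1 p.2 q.1 q.2 α) := by
  set E := Real.exp (μ * (∑ j, p.1 j * (starRingEnd ℂ) (q.1 j)).re) with hE
  have hlt : E * ∑ i, ‖p.2 i‖ * ‖q.2 i‖ < 1 := fbh_ratio_lt n m μ hμ p q hp hq
  have hE0 : 0 < E := Real.exp_pos _
  refine Summable.of_norm ?_
  simp only [fbh_norm_term n m μ _ _ _ _ _ E hE]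
  refine fbh_summable_multi m
    (fun k => ((m + k).choose k : ℝ) * ((k : ℝ) + m) ^ n * E ^ m)
    (fun k => by positivity) (fun i => E * (‖p.2 i‖ * ‖q.2 i‖)) (fun i => by positivity) ?_
  rw [← Finset.mul_sum]
  have hr0 : 0 ≤ E * ∑ i, ‖p.2 i‖ * ‖q.2 i‖ :=
    mul_nonneg hE0.le (Finset.sum_nonneg fun i _ => by positivity)
  generalize E * ∑ i, ‖p.2 i‖ * ‖q.2 i‖ = r at *
  refine Summable.of_nonneg_of_le (fun k => by positivity) (fun k => ?_)
    ((fbh_summable_poly_geom (m + n) m r hr0 hlt).mul_left (E ^ m))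
  have hc : ((m + k).choose k : ℝ) ≤ ((k : ℝ) + m) ^ m := by
    rw [Nat.choose_symm_add.symm]
    have := Nat.choose_le_pow (m + k) m
    rw [add_comm (k : ℝ)]
    exact_mod_cast this
  calc ((m + k).choose k : ℝ) * ((k : ℝ) + m) ^ n * E ^ m * r ^ k
      ≤ ((k : ℝ) + m) ^ m * ((k : ℝ) + m) ^ n * E ^ m * r ^ k := by gcongr
    _ = _ := by rw [pow_add]; ring
end

section
/- Let n, m be positive integers, μ > 0, and v ∈ ℂ^n. Define φ_v : ℂ^n × ℂ^m → ℂ^n × ℂ^m by φ_v(z,w) = ( z + v , e^{ −μ⟨z,v⟩ − (μ/2)‖v‖² } · w ), where ⟨z,v⟩ = Σ_j z_j · conj(v_j). Then φ_v is holomorphic, maps the Fock–Bargmann–Hartogs domain D_{n,m}(μ) bijectively onto itself, and its inverse on D_{n,m}(μ) is φ_{−v}; in particular φ_v is an automorphism of D_{n,m}(μ). -/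
/-- The map `φ_v(z,w) = (z + v, exp(−μ⟨z,v⟩ − (μ/2)‖v‖²)·w)`, where
`⟨z,v⟩ = ∑ j, z j · conj (v j)`. -/
noncomputable def phiFBH (n m : ℕ) (μ : ℝ) (v : EuclideanSpace ℂ (Fin n)) :
    EuclideanSpace ℂ (Fin n) × EuclideanSpace ℂ (Fin m) →
      EuclideanSpace ℂ (Fin n) × EuclideanSpace ℂ (Fin m) :=
  fun p =>
    (p.1 + v,
      Complex.exp (-(μ : ℂ) * (∑ j, p.1 j * (starRingEnd ℂ) (v j)) -
        (μ : ℂ) / 2 * (‖v‖ : ℂ) ^ 2) • p.2)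

theorem phiFBH_sum_eq (n : ℕ) (z v : EuclideanSpace ℂ (Fin n)) :
    ∑ j, z j * (starRingEnd ℂ) (v j) = inner ℂ v z := by
  simp [PiLp.inner_apply]

theorem phiFBH_leftInv (n m : ℕ) (μ : ℝ) (v : EuclideanSpace ℂ (Fin n))
    (p : EuclideanSpace ℂ (Fin n) × EuclideanSpace ℂ (Fin m)) :
    phiFBH n m μ (-v) (phiFBH n m μ v p) = p := by
  unfold phiFBH
  simp only [phiFBH_sum_eq]
  refine Prod.ext (by simp) ?_
  simp only [smul_smul, ← Complex.exp_add]
  rw [inner_neg_left, inner_add_right, inner_self_eq_norm_sq_to_K, norm_neg]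
  convert one_smul ℂ p.2
  rw [← Complex.exp_zero]
  congr 1
  simp only [Complex.coe_algebraMap]
  ring

theorem phiFBH_mapsTo (n m : ℕ) (μ : ℝ) (v : EuclideanSpace ℂ (Fin n)) :
    Set.MapsTo (phiFBH n m μ v) (FBH n m μ) (FBH n m μ) := by
  intro p hp
  simp only [FBH, Set.mem_setOf_eq, phiFBH, phiFBH_sum_eq] at hp ⊢
  rw [norm_smul, Complex.norm_exp, mul_pow, ← Real.exp_nat_mul]
  have h1 : -μ * ‖p.1 + v‖ ^ 2 = (-2 * μ * (inner ℂ v p.1 : ℂ).re - μ * ‖v‖ ^ 2)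
      + -μ * ‖p.1‖ ^ 2 := by
    rw [add_comm p.1 v, @norm_add_sq ℂ]
    simp only [RCLike.re_eq_complex_re]
    ring
  have h2 : (-(μ : ℂ) * (inner ℂ v p.1 : ℂ) - (μ : ℂ) / 2 * (‖v‖ : ℂ) ^ 2).re
      = -μ * (inner ℂ v p.1 : ℂ).re - μ / 2 * ‖v‖ ^ 2 := by
    have : (μ : ℂ) / 2 * (‖v‖ : ℂ) ^ 2 = ((μ / 2 * ‖v‖ ^ 2 : ℝ) : ℂ) := by push_cast; rfl
    rw [this, Complex.sub_re, Complex.ofReal_re, ← Complex.ofReal_neg, Complex.re_ofReal_mul]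
  rw [h1, Real.exp_add, h2]
  have h3 : ((2 : ℕ) : ℝ) * (-μ * (inner ℂ v p.1 : ℂ).re - μ / 2 * ‖v‖ ^ 2)
      = -2 * μ * (inner ℂ v p.1 : ℂ).re - μ * ‖v‖ ^ 2 := by push_cast; ring
  rw [h3]
  exact mul_lt_mul_of_pos_left hp (Real.exp_pos _)

/-- `φ_v` is holomorphic, maps `D_{n,m}(μ)` bijectively onto itself, and its
inverse on `D_{n,m}(μ)` is `φ_{−v}`; in particular `φ_v` is an automorphism of
`D_{n,m}(μ)`. -/
theorem phiFBH_is_automorphism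
    (n m : ℕ) (hn : 0 < n) (hm : 0 < m) (μ : ℝ) (hμ : 0 < μ)
    (v : EuclideanSpace ℂ (Fin n)) :
    Differentiable ℂ (phiFBH n m μ v) ∧
    Set.BijOn (phiFBH n m μ v) (FBH n m μ) (FBH n m μ) ∧
    (∀ p ∈ FBH n m μ, phiFBH n m μ (-v) (phiFBH n m μ v p) = p) ∧
    (∀ p ∈ FBH n m μ, phiFBH n m μ v (phiFBH n m μ (-v) p) = p) := by
  have hr : ∀ p, phiFBH n m μ v (phiFBH n m μ (-v) p) = p := fun p => by
    simpa using phiFBH_leftInv n m μ (-v) p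
  refine ⟨?_, ?_, fun p _ => phiFBH_leftInv n m μ v p, fun p _ => hr p⟩
  · unfold phiFBH
    simp only [phiFBH_sum_eq]
    have h : Differentiable ℂ
        (fun p : EuclideanSpace ℂ (Fin n) × EuclideanSpace ℂ (Fin m) => (inner ℂ v p.1 : ℂ)) :=
      (innerSL ℂ v).differentiable.comp differentiable_fst
    fun_prop
  · exact Set.InvOn.bijOn ⟨fun p _ => phiFBH_leftInv n m μ v p, fun p _ => hr p⟩
      (phiFBH_mapsTo n m μ v) (phiFBH_mapsTo n m μ (-v))
end

section
/- Let n be a positive integer and μ > 0. Define Φ : ℂ^n × ℂ → ℂ^n × ℂ by Φ(z₁,…,z_n,w₁) = (√2·z₁,…,√2·z_n, w₁²). Then Φ is a proper holomorphic self-mapping of the Fock–Bargmann–Hartogs domain D_{n,1}(μ): it is holomorphic, maps D_{n,1}(μ) onto D_{n,1}(μ), and the preimage under Φ of every compact subset of D_{n,1}(μ) intersected with D_{n,1}(μ) is compact; moreover Φ is not injective on D_{n,1}(μ), hence is not an automorphism of D_{n,1}(μ). -/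
/-- The Fock–Bargmann–Hartogs domain `D_{n,1}(μ)` with one-dimensional fiber:
`{(z,w) ∈ ℂ^n × ℂ : |w|² < exp (−μ‖z‖²)}`. -/
def FBH1 (n : ℕ) (μ : ℝ) : Set (EuclideanSpace ℂ (Fin n) × ℂ) :=
  {p | ‖p.2‖ ^ 2 < Real.exp (-μ * ‖p.1‖ ^ 2)}

theorem FBH1_mem_iff (n : ℕ) (μ : ℝ) (p : EuclideanSpace ℂ (Fin n) × ℂ) :
    ((Real.sqrt 2 : ℂ) • p.1, p.2 ^ 2) ∈ FBH1 n μ ↔ p ∈ FBH1 n μ := by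
  simp only [FBH1, Set.mem_setOf_eq]
  have h1 : ‖(Real.sqrt 2 : ℂ) • p.1‖ ^ 2 = 2 * ‖p.1‖ ^ 2 := by
    rw [norm_smul, mul_pow, Complex.norm_real, Real.norm_eq_abs, sq_abs,
      Real.sq_sqrt (by norm_num)]
  have h2 : Real.exp (-μ * (2 * ‖p.1‖ ^ 2)) = (Real.exp (-μ * ‖p.1‖ ^ 2)) ^ 2 := by
    rw [← Real.exp_nat_mul]
    congr 1
    push_cast
    ring
  have h3 : ‖p.2 ^ 2‖ ^ 2 = (‖p.2‖ ^ 2) ^ 2 := by rw [norm_pow]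
  rw [h1, h2, h3]
  exact pow_lt_pow_iff_left₀ (by positivity) (by positivity) (by norm_num)

/-- `Φ(z,w) = (√2·z, w²)` is a proper holomorphic self-mapping of `D_{n,1}(μ)`
onto itself which is not injective, hence not an automorphism. -/
theorem squaring_map_proper_not_injective
    (n : ℕ) (hn : 0 < n) (μ : ℝ) (hμ : 0 < μ) :
    Differentiable ℂ (fun p : EuclideanSpace ℂ (Fin n) × ℂ =>
      ((Real.sqrt 2 : ℂ) • p.1, p.2 ^ 2)) ∧
    (fun p : EuclideanSpace ℂ (Fin n) × ℂ =>
      ((Real.sqrt 2 : ℂ) • p.1, p.2 ^ 2)) '' FBH1 n μ = FBH1 n μ ∧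
    (∀ K : Set (EuclideanSpace ℂ (Fin n) × ℂ),
      K ⊆ FBH1 n μ → IsCompact K →
      IsCompact ((fun p : EuclideanSpace ℂ (Fin n) × ℂ =>
        ((Real.sqrt 2 : ℂ) • p.1, p.2 ^ 2)) ⁻¹' K ∩ FBH1 n μ)) ∧
    ¬ Set.InjOn (fun p : EuclideanSpace ℂ (Fin n) × ℂ =>
      ((Real.sqrt 2 : ℂ) • p.1, p.2 ^ 2)) (FBH1 n μ) := by
  have hs : (Real.sqrt 2 : ℂ) ≠ 0 := by
    norm_num
  have hd : Differentiable ℂ (fun p : EuclideanSpace ℂ (Fin n) × ℂ =>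
      ((Real.sqrt 2 : ℂ) • p.1, p.2 ^ 2)) := by
    fun_prop
  refine ⟨hd, ?_, ?_, ?_⟩
  · ext q
    constructor
    · rintro ⟨p, hp, rfl⟩
      exact (FBH1_mem_iff n μ p).2 hp
    · intro hq
      obtain ⟨w, hw⟩ := IsAlgClosed.exists_pow_nat_eq q.2 (n := 2) (by norm_num)
      have he : ((Real.sqrt 2 : ℂ) • ((Real.sqrt 2 : ℂ)⁻¹ • q.1), w ^ 2) = q := by
        rw [smul_inv_smul₀ hs, hw]
      refine ⟨((Real.sqrt 2 : ℂ)⁻¹ • q.1, w), ?_, he⟩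
      rw [← FBH1_mem_iff]
      simpa only [he] using hq
  · intro K hK hc
    apply Metric.isCompact_of_isClosed_isBounded
    · have : ((fun p : EuclideanSpace ℂ (Fin n) × ℂ =>
        ((Real.sqrt 2 : ℂ) • p.1, p.2 ^ 2)) ⁻¹' K ∩ FBH1 n μ) =
          ((fun p : EuclideanSpace ℂ (Fin n) × ℂ =>
        ((Real.sqrt 2 : ℂ) • p.1, p.2 ^ 2)) ⁻¹' K) :=
        Set.inter_eq_left.2 fun p hp => (FBH1_mem_iff n μ p).1 (hK hp)
      rw [this]
      exact hc.isClosed.preimage hd.continuous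
    · obtain ⟨R, hR⟩ := hc.isBounded.exists_norm_le
      refine isBounded_iff_forall_norm_le.2 ⟨R + 1, ?_⟩
      rintro p ⟨hp, -⟩
      have h := hR _ hp
      rw [norm_prod_le_iff] at h
      obtain ⟨ha, hb⟩ := h
      simp only [norm_smul, norm_pow, Complex.norm_real, Real.norm_eq_abs,
        abs_of_nonneg (Real.sqrt_nonneg 2)] at ha hb
      have h1 : 1 ≤ Real.sqrt 2 := Real.one_le_sqrt.2 (by norm_num)
      rw [norm_prod_le_iff]
      constructor
      · nlinarith [norm_nonneg p.1]
      · nlinarith [sq_nonneg (‖p.2‖ - 1)]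
  · intro h
    have h1 : ((0 : EuclideanSpace ℂ (Fin n)), (1 / 2 : ℂ)) ∈ FBH1 n μ := by
      norm_num [FBH1]
    have h2 : ((0 : EuclideanSpace ℂ (Fin n)), (-(1 / 2) : ℂ)) ∈ FBH1 n μ := by
      norm_num [FBH1]
    have h3 := congrArg Prod.snd (h h1 h2 (by norm_num))
    norm_num at h3
end
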